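/- arXiv:1606.05301 — 7 statements merged into one kernel-verified Lean document; each statement's English description precedes it below -/
import Mathlib

section
/- Suppose for some i ∈ I and w ∈ ℂ we have Q_i(w) = 0 and Q̃_i(w) ≠ 0, together with the genericity condition: Q_j(w) ≠ 0 for every j with C(i,j) = −2, and Q_j(w·q) ≠ 0 and Q_j(w·q^{−1}) ≠ 0 for every j with C(i,j) = −3. Then the Bethe Ansatz equation holds at w: Q_i(w·q^{B(i,i)}) · ∏_{j ≠ i, C(i,j) < 0} Q_j(w·q^{B(i,j)}) + v_i² · Q_i(w·q^{−B(i,i)}) · ∏_{j ≠ i, C(i,j) < 0} Q_j(w·q^{−B(i,j)}) = 0 (equivalently, v_i^{−2} · ∏_j Q_j(w q^{B(i,j)}) / ∏_j Q_j(w q^{−B(i,j)}) = −1 whenever all factors appearing in the denominator are nonzero). -/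
open Finset

/-- For an off-diagonal Cartan entry `c` and symmetrizing integer `e` (with `e = 1` unless `c = -1`),
the shift of `∏ₖ f (w q ^ (c + 1 + 2k))` by `q ^ e` against the shift by `q ^ (-e)` leaves
only the boundary values `f (w q ^ (± e c))`. -/
theorem shifted_prod_mul_eq {q : ℂ} (hq : q ≠ 0) (f : ℂ → ℂ) (w : ℂ) {c e : ℤ}
    (h : c = -1 ∨ (c = -2 ∨ c = -3) ∧ e = 1) :
    (∏ k ∈ Finset.range (-c).toNat, f (w * q ^ e * q ^ (c + 1 + 2 * (k : ℤ)))) *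
        f (w * q ^ (e * c))
      = (∏ k ∈ Finset.range (-c).toNat, f (w * q ^ (-e) * q ^ (c + 1 + 2 * (k : ℤ)))) *
        f (w * q ^ (-(e * c))) := by
  simp only [mul_assoc w, ← zpow_add₀ hq]
  rcases h with rfl | ⟨rfl | rfl, rfl⟩
  · simp [mul_comm]
  · rw [show (-(-2 : ℤ)).toNat = 2 from rfl]
    simp only [Finset.prod_range_succ, Finset.prod_range_zero]
    norm_num
    ring
  · rw [show (-(-3 : ℤ)).toNat = 3 from rfl]
    simp only [Finset.prod_range_succ, Finset.prod_range_zero]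
    norm_num
    ring

/-- In a symmetrizable Cartan matrix of finite type, a double or triple bond leaving `i`
forces the symmetrizing integer of `i` to be `1`. -/
theorem symmetrizer_eq_one_of_multiple_bond {a b e e' : ℤ}
    (ha : a = -2 ∨ a = -3) (hb : b = -1 ∨ b = -2 ∨ b = -3) (hab : a * b ≤ 3)
    (he' : e' = 1 ∨ e' = 2 ∨ e' = 3)
    (h : e * a = e' * b) : e = 1 := by
  rcases ha with rfl | rfl <;> rcases hb with rfl | rfl | rfl <;> omega

/-- **Bethe Ansatz equations from the QQ̃-system** (Frenkel–Hernandez).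
Given a finite-type Cartan matrix `C` with symmetrizing integers `d` (values in `{1,2,3}`),
`B i j = d i * C i j`, a nonzero `q : ℂ`, functions `Q`, `Qt` and nonzero constants `v`
satisfying the `QQ̃`-system, if `Q i w = 0`, `Qt i w ≠ 0` and the genericity condition holds,
then the Bethe Ansatz equation holds at `w`. -/
theorem bethe_ansatz_from_QQtilde_system
    {I : Type*} [Fintype I] [DecidableEq I]
    (C : I → I → ℤ) (d : I → ℤ)
    (hCdiag : ∀ i, C i i = 2)
    (hCoff : ∀ i j, i ≠ j → C i j = 0 ∨ C i j = -1 ∨ C i j = -2 ∨ C i j = -3)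
    (hCzero : ∀ i j, C i j = 0 ↔ C j i = 0)
    (hCprod : ∀ i j, i ≠ j → C i j * C j i ≤ 3)
    (hd : ∀ i, d i = 1 ∨ d i = 2 ∨ d i = 3)
    (hdsym : ∀ i j, d i * C i j = d j * C j i)
    (q : ℂ) (hq : q ≠ 0)
    (Q Qt : I → ℂ → ℂ) (v : I → ℂ) (hv : ∀ i, v i ≠ 0)
    (P : I → ℂ → ℂ)
    (hP : ∀ i u, P i u =
      ∏ j ∈ univ.filter (fun j => j ≠ i ∧ C i j < 0),
        ∏ k ∈ Finset.range (-(C i j)).toNat,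
          Q j (u * q ^ (C i j + 1 + 2 * (k : ℤ))))
    (hQQ : ∀ i u,
      v i * Q i (u * q ^ (-(d i))) * Qt i (u * q ^ (d i))
        - (v i)⁻¹ * Q i (u * q ^ (d i)) * Qt i (u * q ^ (-(d i))) = P i u)
    (i : I) (w : ℂ)
    (hQw : Q i w = 0) (hQtw : Qt i w ≠ 0)
    (hgen2 : ∀ j, C i j = -2 → Q j w ≠ 0)
    (hgen3 : ∀ j, C i j = -3 → Q j (w * q) ≠ 0 ∧ Q j (w * q⁻¹) ≠ 0) :
    Q i (w * q ^ (d i * C i i)) *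
        (∏ j ∈ univ.filter (fun j => j ≠ i ∧ C i j < 0), Q j (w * q ^ (d i * C i j)))
      + v i ^ 2 * Q i (w * q ^ (-(d i * C i i))) *
        (∏ j ∈ univ.filter (fun j => j ≠ i ∧ C i j < 0), Q j (w * q ^ (-(d i * C i j))))
      = 0 := by
  have h_ratio : P i (w * q ^ d i) *
        (∏ j ∈ univ.filter (fun j => j ≠ i ∧ C i j < 0), Q j (w * q ^ (d i * C i j)))
      = P i (w * q ^ (-(d i))) *
        (∏ j ∈ univ.filter (fun j => j ≠ i ∧ C i j < 0), Q j (w * q ^ (-(d i * C i j)))) := by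
    rw [hP, hP, ← Finset.prod_mul_distrib, ← Finset.prod_mul_distrib]
    refine Finset.prod_congr rfl fun j hj => shifted_prod_mul_eq hq (Q j) w ?_
    obtain ⟨hji, hneg⟩ := (Finset.mem_filter.mp hj).2
    have hCji : C j i ≠ 0 := fun h => hneg.ne ((hCzero i j).mpr h)
    rcases hCoff i j hji.symm with h | h | h
    · omega
    · exact Or.inl h
    · exact Or.inr ⟨h, symmetrizer_eq_one_of_multiple_bond h
        ((hCoff j i hji).resolve_left hCji) (hCprod i j hji.symm) (hd j) (hdsym i j)⟩
  have h_plus := hQQ i (w * q ^ d i)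
  have h_minus := hQQ i (w * q ^ (-(d i)))
  simp only [mul_assoc w, ← zpow_add₀ hq, add_neg_cancel, neg_add_cancel, zpow_zero, mul_one,
    hQw, mul_zero, zero_mul, zero_sub, sub_zero] at h_plus h_minus
  rw [← h_plus, ← h_minus] at h_ratio
  rw [hCdiag, mul_two, neg_add]
  have hvi := hv i
  field_simp at h_ratio
  linear_combination -h_ratio
end

section
/- Suppose for some i ∈ I and w ∈ ℂ we have Q_i(w) = 0. Then, with no further genericity assumptions, the following cross-relation holds: v_i² · Q_i(w·q_i^{−2}) · P_i(w·q_i) + Q_i(w·q_i^{2}) · P_i(w·q_i^{−1}) = 0. -/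
open Finset

/-- **Cross relation from the QQ̃-system** (Frenkel–Hernandez).
Given a finite-type Cartan matrix `C` with symmetrizing integers `d` (values in `{1,2,3}`),
a nonzero `q : ℂ`, functions `Q`, `Qt` and nonzero constants `v` satisfying the
`QQ̃`-system, if `Q i w = 0` then (with no further genericity assumptions)
`v i ^ 2 * Q i (w * q_i⁻²) * P i (w * q_i) + Q i (w * q_i²) * P i (w * q_i⁻¹) = 0`. -/
theorem cross_relation_from_QQtilde_system
    {I : Type*} [Fintype I] [DecidableEq I]
    (C : I → I → ℤ) (d : I → ℤ)
    (hCdiag : ∀ i, C i i = 2)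
    (hCoff : ∀ i j, i ≠ j → C i j = 0 ∨ C i j = -1 ∨ C i j = -2 ∨ C i j = -3)
    (hCzero : ∀ i j, C i j = 0 ↔ C j i = 0)
    (hCprod : ∀ i j, i ≠ j → C i j * C j i ≤ 3)
    (hd : ∀ i, d i = 1 ∨ d i = 2 ∨ d i = 3)
    (hdsym : ∀ i j, d i * C i j = d j * C j i)
    (q : ℂ) (hq : q ≠ 0)
    (Q Qt : I → ℂ → ℂ) (v : I → ℂ) (hv : ∀ i, v i ≠ 0)
    (P : I → ℂ → ℂ)
    (hP : ∀ i u, P i u =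
      ∏ j ∈ univ.filter (fun j => j ≠ i ∧ C i j < 0),
        ∏ k ∈ Finset.range (-(C i j)).toNat,
          Q j (u * q ^ (C i j + 1 + 2 * (k : ℤ))))
    (hQQ : ∀ i u,
      v i * Q i (u * q ^ (-(d i))) * Qt i (u * q ^ (d i))
        - (v i)⁻¹ * Q i (u * q ^ (d i)) * Qt i (u * q ^ (-(d i))) = P i u)
    (i : I) (w : ℂ)
    (hQw : Q i w = 0) :
    v i ^ 2 * Q i (w * q ^ (-(2 * d i))) * P i (w * q ^ (d i))
      + Q i (w * q ^ (2 * d i)) * P i (w * q ^ (-(d i))) = 0 := by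
  have h₁ : w * q ^ d i * q ^ (-(d i)) = w := by
    rw [mul_assoc, ← zpow_add₀ hq, add_neg_cancel, zpow_zero, mul_one]
  have h₂ : w * q ^ (-(d i)) * q ^ d i = w := by
    rw [mul_assoc, ← zpow_add₀ hq, neg_add_cancel, zpow_zero, mul_one]
  have h₃ : w * q ^ d i * q ^ d i = w * q ^ (2 * d i) := by
    rw [mul_assoc, ← zpow_add₀ hq, two_mul]
  have h₄ : w * q ^ (-(d i)) * q ^ (-(d i)) = w * q ^ (-(2 * d i)) := by
    rw [mul_assoc, ← zpow_add₀ hq, two_mul, neg_add]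
  rw [← hQQ i (w * q ^ d i), ← hQQ i (w * q ^ (-(d i))), h₁, h₂, h₃, h₄, hQw]
  have hvi := hv i
  field_simp
  ring
end

section
/- If Q(w) = 0 for some w ∈ ℂ, then necessarily Q̃(w) ≠ 0, and the Bethe Ansatz equation Q(w·q²) + v²·Q(w·q^{−2}) = 0 holds (equivalently, v^{−2}·Q(w q²)/Q(w q^{−2}) = −1 when Q(w q^{−2}) ≠ 0). -/
/-- **Bethe Ansatz for `sl₂` from the quantum Wronskian relation**
(Bazhanov–Lukyanov–Zamolodchikov; Frenkel–Hernandez).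
If `Q`, `Qt` satisfy the `sl₂` quantum Wronskian relation
`v * Q (u q⁻¹) * Qt (u q) - v⁻¹ * Q (u q) * Qt (u q⁻¹) = 1` for all `u`,
and `Q w = 0`, then `Qt w ≠ 0` and the Bethe Ansatz equation
`Q (w q²) + v² * Q (w q⁻²) = 0` holds. -/
theorem bethe_ansatz_sl2_from_quantum_wronskian
    (q v : ℂ) (hq : q ≠ 0) (hv : v ≠ 0)
    (Q Qt : ℂ → ℂ)
    (hQQ : ∀ u : ℂ, v * Q (u * q⁻¹) * Qt (u * q) - v⁻¹ * Q (u * q) * Qt (u * q⁻¹) = 1)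
    (w : ℂ) (hQw : Q w = 0) :
    Qt w ≠ 0 ∧ Q (w * q ^ (2 : ℤ)) + v ^ 2 * Q (w * q ^ (-2 : ℤ)) = 0 := by
  have hplus : v⁻¹ * Q (w * q ^ (2 : ℤ)) * Qt w = -1 := by
    have h := hQQ (w * q)
    have e₁ : w * q * q⁻¹ = w := by field_simp
    have e₂ : w * q * q = w * q ^ (2 : ℤ) := by rw [zpow_ofNat]; ring
    rw [e₁, e₂, hQw] at h
    linear_combination -h
  have hminus : v * Q (w * q ^ (-2 : ℤ)) * Qt w = 1 := by
    have h := hQQ (w * q⁻¹)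
    have e₁ : w * q⁻¹ * q = w := by field_simp
    have e₂ : w * q⁻¹ * q⁻¹ = w * q ^ (-2 : ℤ) := by rw [zpow_neg, zpow_ofNat]; ring
    rw [e₁, e₂, hQw] at h
    linear_combination h
  have hQt : Qt w ≠ 0 := by
    intro h
    simp [h] at hminus
  refine ⟨hQt, mul_right_cancel₀ hQt ?_⟩
  linear_combination v * hplus + v * hminus - Q (w * q ^ (2 : ℤ)) * Qt w * mul_inv_cancel₀ hv
end

section
/- If Q(w) = 0 for some w ∈ ℂ, then the Bethe Ansatz equation of the quantum gl₁ toroidal algebra holds at w: Q(w·q₁)·Q(w·q₂)·Q(w·q₃) + v²·Q(w·q₁^{−1})·Q(w·q₂^{−1})·Q(w·q₃^{−1}) = 0. -/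
/-- **Bethe Ansatz for the quantum `gl₁` toroidal algebra** (Frenkel–Hernandez;
cf. Feigin–Jimbo–Miwa–Mukhin). Let `q₂ = q²` and `q₁ q₂ q₃ = 1`, and suppose `Q`, `Qt`
satisfy the `QQ̃`-system of the quantum `gl₁` toroidal algebra:
`v * Q (a q⁻¹) * Qt (a q) - v⁻¹ * Q (a q) * Qt (a q⁻¹) = Q (a q⁻¹ q₁⁻¹) * Q (a q⁻¹ q₃⁻¹)`
for all `a`. If `Q w = 0`, then the Bethe Ansatz equation
`Q (w q₁) Q (w q₂) Q (w q₃) + v² Q (w q₁⁻¹) Q (w q₂⁻¹) Q (w q₃⁻¹) = 0` holds. -/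
theorem bethe_ansatz_gl1_toroidal
    (q q₁ q₂ q₃ v : ℂ)
    (hq : q ≠ 0) (hq₁ : q₁ ≠ 0) (hq₂ : q₂ ≠ 0) (hq₃ : q₃ ≠ 0) (hv : v ≠ 0)
    (h2 : q₂ = q ^ 2) (h123 : q₁ * q₂ * q₃ = 1)
    (Q Qt : ℂ → ℂ)
    (hQQ : ∀ a : ℂ,
      v * Q (a * q⁻¹) * Qt (a * q) - v⁻¹ * Q (a * q) * Qt (a * q⁻¹)
        = Q (a * q⁻¹ * q₁⁻¹) * Q (a * q⁻¹ * q₃⁻¹))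
    (w : ℂ) (hQw : Q w = 0) :
    Q (w * q₁) * Q (w * q₂) * Q (w * q₃)
      + v ^ 2 * Q (w * q₁⁻¹) * Q (w * q₂⁻¹) * Q (w * q₃⁻¹) = 0 := by
  subst h2
  have h₁ : w * q⁻¹ * q⁻¹ * q₁⁻¹ = w * q₃ := by
    field_simp
    linear_combination -w * h123
  have h₃ : w * q⁻¹ * q⁻¹ * q₃⁻¹ = w * q₁ := by
    field_simp
    linear_combination -w * h123
  have hu := hQQ (w * q)
  have hd := hQQ (w * q⁻¹)
  rw [mul_inv_cancel_right₀ hq, hQw, mul_assoc w q q, ← sq] at hu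
  rw [h₁, h₃, inv_mul_cancel_right₀ hq, hQw, mul_assoc w q⁻¹ q⁻¹, ← sq, inv_pow] at hd
  linear_combination
    (-Q (w * q ^ 2)) * hd - v ^ 2 * Q (w * (q ^ 2)⁻¹) * hu
      - v * Q (w * (q ^ 2)⁻¹) * Q (w * q ^ 2) * Qt w * mul_inv_cancel₀ hv
end

section
/- For every i ∈ I and every a ∈ ℂˣ, the following identity holds in the group G of I-tuples of nonzero rational functions: [−α_i] · A_{i,a} = Ψ_{i, a q_i^{−2}} · Ψ_{i, a q_i^{2}}^{−1} · ∏_{j ≠ i, C(i,j) < 0, d(j) > 1} Ψ_{j, a q_j^{−1}}^{−1} · Ψ_{j, a q_j} · ∏_{j ≠ i, C(i,j) < 0, d(j) = 1} Ψ_{j, a q_i^{−1}}^{−1} · Ψ_{j, a q_i}. (This is the identity Ã_{i,a} = [−α_i]·A_{i,a} relating the ℓ-weight analogue of a simple root to the evaluated monomial A_{i,a}, used in the proof of the QQ̃-system.) -/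
open Finset

namespace QQtilde

variable {I : Type*}

/-- The ℓ-weight `Ψ_{i,a}`: the `I`-tuple of rational functions whose `i`-component
is `1 - a z` and whose other components are `1`. -/
noncomputable def Psi [DecidableEq I] (i : I) (a : ℂ) : I → RatFunc ℂ :=
  fun j => if j = i then 1 - RatFunc.C a * RatFunc.X else 1

/-- The evaluated variable `Y_{i,a}`: the `I`-tuple whose `i`-component is
`q_i (1 - a q_i⁻¹ z) / (1 - a q_i z)` and whose other components are `1`,
where `q_i = q ^ d i`. -/
noncomputable def Y [DecidableEq I] (d : I → ℤ) (q : ℂ) (i : I) (a : ℂ) : I → RatFunc ℂ :=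
  fun j => if j = i then
      RatFunc.C (q ^ d i) * (1 - RatFunc.C (a * q ^ (-(d i))) * RatFunc.X) /
        (1 - RatFunc.C (a * q ^ d i) * RatFunc.X)
    else 1

/-- The constant tuple `[-α_i]`, whose `j`-component is `q_j ^ (-C j i)`. -/
noncomputable def negAlpha (d : I → ℤ) (C : I → I → ℤ) (q : ℂ) (i : I) : I → RatFunc ℂ :=
  fun j => RatFunc.C (q ^ (-(d j * C j i)))

/-- The evaluated monomial `A_{i,a}`. -/
noncomputable def A [Fintype I] [DecidableEq I] (d : I → ℤ) (C : I → I → ℤ)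
    (q : ℂ) (i : I) (a : ℂ) : I → RatFunc ℂ :=
  Y d q i (a * q ^ (-(d i))) * Y d q i (a * q ^ d i) *
    ((∏ j ∈ univ.filter (fun j => C j i = -1), Y d q j a) *
     (∏ j ∈ univ.filter (fun j => C j i = -2), Y d q j (a * q⁻¹) * Y d q j (a * q)) *
     (∏ j ∈ univ.filter (fun j => C j i = -3),
        Y d q j (a * q ^ (-2 : ℤ)) * Y d q j a * Y d q j (a * q ^ (2 : ℤ))))⁻¹

end QQtilde

namespace QQtilde

theorem prod_filter_apply_eq_ite {ι M : Type*} [Fintype ι] [DecidableEq ι] [CommMonoid M]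
    (p : ι → Prop) [DecidablePred p] (f : ι → ι → M) (k : ι) (hf : ∀ j, j ≠ k → f j k = 1) :
    (∏ j ∈ univ.filter p, f j) k = if p k then f k k else 1 := by
  rw [Finset.prod_apply, Finset.prod_filter, Finset.prod_eq_single k]
  · intro j _ hj
    simp [hf j hj]
  · simp

theorem one_sub_C_mul_X_ne_zero {K : Type*} [Field K] (c : K) :
    (1 - RatFunc.C c * RatFunc.X : RatFunc K) ≠ 0 := by
  have h : (1 - Polynomial.C c * Polynomial.X : Polynomial K) ≠ 0 := by
    intro h
    simpa using congrArg (Polynomial.eval 0) h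
  have h' := RatFunc.algebraMap_ne_zero h
  simpa using h'

theorem Psi_apply_self {I : Type*} [DecidableEq I] (i : I) (a : ℂ) :
    Psi i a i = 1 - RatFunc.C a * RatFunc.X := by
  simp [Psi]

theorem Psi_apply_of_ne {I : Type*} [DecidableEq I] {i j : I} (h : j ≠ i) (a : ℂ) :
    Psi i a j = 1 := by
  simp [Psi, h]

theorem Psi_apply_self_ne_zero {I : Type*} [DecidableEq I] (i : I) (a : ℂ) :
    Psi i a i ≠ 0 := by
  rw [Psi_apply_self]
  exact one_sub_C_mul_X_ne_zero a

theorem Y_apply_self {I : Type*} [DecidableEq I] (d : I → ℤ) (q : ℂ) (i : I) (a : ℂ) :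
    Y d q i a i = RatFunc.C (q ^ d i) * Psi i (a * q ^ (-(d i))) i / Psi i (a * q ^ d i) i := by
  simp [Y, Psi]

theorem Y_apply_of_ne {I : Type*} [DecidableEq I] (d : I → ℤ) (q : ℂ) {i j : I} (h : j ≠ i)
    (a : ℂ) : Y d q i a j = 1 := by
  simp [Y, h]

theorem A_apply {I : Type*} [Fintype I] [DecidableEq I] (d : I → ℤ) (C : I → I → ℤ)
    (q : ℂ) (i : I) (a : ℂ) (k : I) :
    A d C q i a k = Y d q i (a * q ^ (-(d i))) k * Y d q i (a * q ^ d i) k *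
      ((if C k i = -1 then Y d q k a k else 1) *
       (if C k i = -2 then Y d q k (a * q⁻¹) k * Y d q k (a * q) k else 1) *
       (if C k i = -3 then Y d q k (a * q ^ (-2 : ℤ)) k * Y d q k a k *
          Y d q k (a * q ^ (2 : ℤ)) k else 1))⁻¹ := by
  simp only [A, Pi.mul_apply, Pi.inv_apply]
  rw [prod_filter_apply_eq_ite, prod_filter_apply_eq_ite, prod_filter_apply_eq_ite]
  · simp only [Pi.mul_apply]
  all_goals
    intro j hj
    simp [Y_apply_of_ne d q hj.symm]

end QQtilde

open QQtilde

/-- **The identity `Ã_{i,a} = [-α_i] · A_{i,a}`** (Frenkel–Hernandez), in the group of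
`I`-tuples of nonzero rational functions: for a finite-type Cartan matrix `C` with
symmetrizers `d` (values in `{1,2,3}`), `q ≠ 0` and `a ≠ 0`,
`[-α_i] · A_{i,a} = Ψ_{i, a q_i⁻²} Ψ_{i, a q_i²}⁻¹ ·
  ∏_{j ≠ i, C i j < 0, d j > 1} Ψ_{j, a q_j⁻¹}⁻¹ Ψ_{j, a q_j} ·
  ∏_{j ≠ i, C i j < 0, d j = 1} Ψ_{j, a q_i⁻¹}⁻¹ Ψ_{j, a q_i}`. -/
theorem negAlpha_mul_A_eq
    {I : Type*} [Fintype I] [DecidableEq I]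
    (C : I → I → ℤ) (d : I → ℤ)
    (hCdiag : ∀ i, C i i = 2)
    (hCoff : ∀ i j, i ≠ j → C i j = 0 ∨ C i j = -1 ∨ C i j = -2 ∨ C i j = -3)
    (hCzero : ∀ i j, C i j = 0 ↔ C j i = 0)
    (hCprod : ∀ i j, i ≠ j → C i j * C j i ≤ 3)
    (hd : ∀ i, d i = 1 ∨ d i = 2 ∨ d i = 3)
    (hdsym : ∀ i j, d i * C i j = d j * C j i)
    (q : ℂ) (hq : q ≠ 0)
    (i : I) (a : ℂ) (ha : a ≠ 0) :
    negAlpha d C q i * A d C q i a =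
      Psi i (a * q ^ (-(2 * d i))) * (Psi i (a * q ^ (2 * d i)))⁻¹ *
        (∏ j ∈ univ.filter (fun j => j ≠ i ∧ C i j < 0 ∧ 1 < d j),
          (Psi j (a * q ^ (-(d j))))⁻¹ * Psi j (a * q ^ d j)) *
        (∏ j ∈ univ.filter (fun j => j ≠ i ∧ C i j < 0 ∧ d j = 1),
          (Psi j (a * q ^ (-(d i))))⁻¹ * Psi j (a * q ^ d i)) := by
  funext k
  simp only [Pi.mul_apply, Pi.inv_apply, A_apply]
  rw [prod_filter_apply_eq_ite _ _ k (by
      intro j hj; simp [Psi_apply_of_ne hj.symm]),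
    prod_filter_apply_eq_ite _ _ k (by
      intro j hj; simp [Psi_apply_of_ne hj.symm])]
  simp only [Pi.mul_apply, Pi.inv_apply]
  have hC : ∀ n : ℤ, (RatFunc.C (q ^ n) : RatFunc ℂ) ≠ 0 := fun n => by
    rw [ne_eq, map_eq_zero]
    exact zpow_ne_zero n hq
  have hP := Psi_apply_self_ne_zero k
  by_cases hk : k = i
  · subst hk
    have e₁ : a * q ^ (-d k) * q ^ (-d k) = a * q ^ (-(2 * d k)) := by
      rw [mul_assoc, ← zpow_add₀ hq]; ring_nf
    have e₂ : a * q ^ d k * q ^ d k = a * q ^ (2 * d k) := by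
      rw [mul_assoc, ← zpow_add₀ hq]; ring_nf
    have e₃ : a * q ^ (-d k) * q ^ d k = a := by
      rw [mul_assoc, ← zpow_add₀ hq]; simp
    have e₄ : a * q ^ d k * q ^ (-d k) = a := by
      rw [mul_assoc, ← zpow_add₀ hq]; simp
    have e₅ : (RatFunc.C (q ^ (-(d k * 2))) : RatFunc ℂ) =
        (RatFunc.C (q ^ d k) * RatFunc.C (q ^ d k))⁻¹ := by
      rw [← map_mul, ← map_inv₀, ← zpow_add₀ hq, ← zpow_neg]; ring_nf
    simp only [negAlpha, hCdiag, Y_apply_self, e₁, e₂, e₃, e₄, e₅]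
    have h₀ := hC (d k)
    have h₁ := hP a
    have h₂ := hP (a * q ^ (2 * d k))
    generalize Psi k (a * q ^ (2 * d k)) k = P₂ at h₂ ⊢
    generalize RatFunc.C (q ^ d k) = Q at h₀ ⊢
    norm_num
    field_simp
  · simp only [Y_apply_of_ne d q hk, Psi_apply_of_ne hk, ne_eq, hk, not_false_eq_true, true_and]
    have hs := hdsym i k
    have hp := hCprod i k (Ne.symm hk)
    have hz := hCzero i k
    have hik := hCoff i k (Ne.symm hk)
    have hdi := hd i
    have hdk := hd k
    have h₀ := hC 1
    rw [zpow_one] at h₀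
    rcases hCoff k i hk with h | h | h | h
    · simp [negAlpha, h, hz.2 h]
    · have hneg : C i k < 0 := by
        rw [h] at hz; omega
      have hd₁ : d k = 1 → d i = 1 := by
        intro hk₁
        rw [h, hk₁] at hs
        rcases hdi with h' | h' | h' <;> rw [h'] at hs <;> omega
      have h₁ := hC (d k)
      have h₂ := hP (a * q ^ d k)
      have h₃ := hP (a * q ^ (-d k))
      have key : negAlpha d C q i k * (Y d q k a k)⁻¹ =
          (Psi k (a * q ^ (-d k)) k)⁻¹ * Psi k (a * q ^ d k) k := by
        simp only [negAlpha, h, Y_apply_self, mul_neg, mul_one, neg_neg]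
        field_simp
      rcases (by omega : d k = 1 ∨ 1 < d k) with h' | h'
      · have hi := hd₁ h'
        simp only [h', hi] at key ⊢
        simpa [h, hneg] using key
      · have hne : d k ≠ 1 := by omega
        simpa [h, hneg, h', hne] using key
    · have hv : C i k = -1 ∧ d k = 1 ∧ d i = 2 := by
        rw [h] at hs hp hz
        rcases hdi with h' | h' | h' <;> rw [h'] at hs <;> omega
      obtain ⟨hc, hk₁, hi⟩ := hv
      have e₁ : a * q⁻¹ * q ^ (-1 : ℤ) = a * q ^ (-2 : ℤ) := by
        field_simp
      have e₂ : a * q * q ^ (1 : ℤ) = a * q ^ (2 : ℤ) := by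
        field_simp
      have e₃ : a * q⁻¹ * q ^ (1 : ℤ) = a := by field_simp
      have e₄ : a * q * q ^ (-1 : ℤ) = a := by field_simp
      have h₁ := hP a
      have h₂ := hP (a * q ^ (2 : ℤ))
      have h₃ := hP (a * q ^ (-2 : ℤ))
      simp only [negAlpha, h, hc, hk₁, hi, Y_apply_self, e₁, e₂, e₃, e₄]
      generalize Psi k (a * q ^ (2 : ℤ)) k = P₂ at h₂ ⊢
      generalize Psi k (a * q ^ (-2 : ℤ)) k = P₃ at h₃ ⊢
      norm_num
      field_simp
    · have hv : C i k = -1 ∧ d k = 1 ∧ d i = 3 := by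
        rw [h] at hs hp hz
        rcases hdi with h' | h' | h' <;> rw [h'] at hs <;> omega
      obtain ⟨hc, hk₁, hi⟩ := hv
      have e₁ : a * q ^ (-2 : ℤ) * q ^ (-1 : ℤ) = a * q ^ (-3 : ℤ) := by
        rw [mul_assoc, ← zpow_add₀ hq]; norm_num
      have e₂ : a * q ^ (2 : ℤ) * q ^ (1 : ℤ) = a * q ^ (3 : ℤ) := by
        rw [mul_assoc, ← zpow_add₀ hq]; norm_num
      have e₃ : a * q ^ (-2 : ℤ) * q ^ (1 : ℤ) = a * q ^ (-1 : ℤ) := by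
        rw [mul_assoc, ← zpow_add₀ hq]; norm_num
      have e₄ : a * q ^ (2 : ℤ) * q ^ (-1 : ℤ) = a * q ^ (1 : ℤ) := by
        rw [mul_assoc, ← zpow_add₀ hq]; norm_num
      have h₁ := hP (a * q ^ (1 : ℤ))
      have h₂ := hP (a * q ^ (-1 : ℤ))
      have h₃ := hP (a * q ^ (3 : ℤ))
      have h₄ := hP (a * q ^ (-3 : ℤ))
      simp only [negAlpha, h, hc, hk₁, hi, Y_apply_self, e₁, e₂, e₃, e₄]
      generalize Psi k (a * q ^ (1 : ℤ)) k = P₁ at h₁ ⊢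
      generalize Psi k (a * q ^ (-1 : ℤ)) k = P₂ at h₂ ⊢
      generalize Psi k (a * q ^ (3 : ℤ)) k = P₃ at h₃ ⊢
      generalize Psi k (a * q ^ (-3 : ℤ)) k = P₄ at h₄ ⊢
      norm_num
      field_simp
end

section
/- Let k ∈ ℝ with k > −2, set α = −(k+1)/(k+2) (so that 2α+2 = 2/(k+2) > 0), and let r, λ ∈ ℝ. For z > 0 put v(z) = r(r+1)/z² + 1/z + λ·z^k, and for x > 0 put φ(x) = x^{2α+2}/(2α+2)². Then for every x > 0: v(φ(x))·φ'(x)² − (1/2)·{φ, x} = L/x² + x^{2α} − E, where L := 4(α+1)²·r(r+1) + α² + 2α + 3/4, E := −(2α+2)^{2α/(α+1)}·λ, and {φ, x} = φ'''(x)/φ'(x) − (3/2)·(φ''(x)/φ'(x))²; here one uses that 2α/(α+1) = −2(k+1), so that λ·φ(x)^k·φ'(x)² is the constant λ·(2α+2)^{−2(k+1)} = −E. -/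
theorem deriv_eq_const_mul_rpow {f : ℝ → ℝ} {a p : ℝ} (hf : ∀ x : ℝ, 0 < x → f x = a * x ^ p)
    (x : ℝ) (hx : 0 < x) : deriv f x = a * p * x ^ (p - 1) := by
  have h : f =ᶠ[nhds x] fun y => a * y ^ p := by
    filter_upwards [Ioi_mem_nhds hx] with y hy using hf y hy
  rw [h.deriv_eq, ((Real.hasDerivAt_rpow_const (Or.inl hx.ne')).const_mul a).deriv, mul_assoc]

/-- **Change of variables `z = x^{2α+2}/(2α+2)²` for the ŝl₂-oper of the highest
weight vector** (Feigin–Frenkel; Bazhanov–Lukyanov–Zamolodchikov).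
For `k > -2`, `α = -(k+1)/(k+2)`, potential `v z = r(r+1)/z² + 1/z + λ z^k` and
`φ x = x^{2α+2}/(2α+2)²`, one has, for all `x > 0`,
`v (φ x) * (φ' x)² - (1/2) {φ, x} = L/x² + x^{2α} - E`, where
`L = 4(α+1)² r(r+1) + α² + 2α + 3/4` and `E = -(2α+2)^{2α/(α+1)} λ`. -/
theorem sl2_oper_change_of_variables
    (k : ℝ) (hk : -2 < k) (r lam : ℝ)
    (α : ℝ) (hα : α = -(k + 1) / (k + 2))
    (v : ℝ → ℝ) (hv : ∀ z : ℝ, 0 < z → v z = r * (r + 1) / z ^ 2 + 1 / z + lam * z ^ k)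
    (φ : ℝ → ℝ) (hφ : ∀ x : ℝ, φ x = x ^ (2 * α + 2) / (2 * α + 2) ^ 2)
    (L E : ℝ)
    (hL : L = 4 * (α + 1) ^ 2 * (r * (r + 1)) + α ^ 2 + 2 * α + 3 / 4)
    (hE : E = -(2 * α + 2) ^ (2 * α / (α + 1)) * lam) :
    ∀ x : ℝ, 0 < x →
      v (φ x) * (deriv φ x) ^ 2
          - (1 / 2) * (deriv (deriv (deriv φ)) x / deriv φ x
              - (3 / 2) * (deriv (deriv φ) x / deriv φ x) ^ 2)
        = L / x ^ 2 + x ^ (2 * α) - E := by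
  obtain ⟨c, hc⟩ : ∃ c, c = 2 * α + 2 := ⟨_, rfl⟩
  have hk2 : 0 < k + 2 := by linarith
  have hck : c * (k + 2) = 2 := by
    rw [hc, hα]
    field_simp
    ring
  have hc0 : 0 < c := pos_of_mul_pos_left (hck.symm ▸ two_pos : 0 < c * (k + 2)) hk2.le
  have hα1 : 0 < α + 1 := by linarith
  have hexp : 2 * α / (α + 1) = -2 * k - 2 := by
    rw [div_eq_iff hα1.ne']
    linear_combination hck - (k + 2) * hc
  have hφ0 : ∀ x : ℝ, 0 < x → φ x = 1 / c ^ 2 * x ^ c := fun x _ => by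
    rw [hφ, ← hc]
    ring
  have hφ1 := deriv_eq_const_mul_rpow hφ0
  have hφ2 := deriv_eq_const_mul_rpow hφ1
  have hφ3 := deriv_eq_const_mul_rpow hφ2
  intro x hx
  have hu : 0 < x ^ c := Real.rpow_pos_of_pos hx c
  have hφpos : 0 < φ x := by
    rw [hφ0 x hx]
    positivity
  have hxα : x ^ (2 * α) = x ^ c / x ^ 2 := by
    rw [show 2 * α = c - 2 by linarith, Real.rpow_sub hx, Real.rpow_two]
  have hφk : φ x ^ k * (x ^ c) ^ 2 = c ^ (-2 * k) * x ^ 2 := by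
    have h₁ : (1 / c ^ 2) ^ k = c ^ (-2 * k) := by
      rw [Real.rpow_mul hc0.le, Real.rpow_neg hc0.le, Real.rpow_two, one_div]
    have h₂ : (x ^ c) ^ k * (x ^ c) ^ 2 = x ^ 2 := by
      rw [← Real.rpow_two (x ^ c), ← Real.rpow_add hu, ← Real.rpow_mul hx.le, hck, Real.rpow_two]
    rw [hφ0 x hx, Real.mul_rpow (by positivity) hu.le, h₁, mul_assoc, h₂]
  have hE' : E = -(c ^ (-2 * k) / c ^ 2) * lam := by
    rw [hE, hexp, ← hc, Real.rpow_sub hc0, Real.rpow_two]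
  have hconst : lam * φ x ^ k * (x ^ c / (c * x)) ^ 2 = -E := by
    rw [hE', div_pow, mul_pow]
    generalize c ^ (-2 * k) = q at hφk ⊢
    field_simp
    linear_combination lam * hφk
  have h₁ : deriv φ x = x ^ c / (c * x) := by
    rw [hφ1 x hx, Real.rpow_sub_one hx.ne']
    field_simp
  have h₂ : deriv (deriv φ) x = (c - 1) * x ^ c / (c * x ^ 2) := by
    rw [hφ2 x hx, Real.rpow_sub_one hx.ne', Real.rpow_sub_one hx.ne']
    field_simp
  have h₃ : deriv (deriv (deriv φ)) x = (c - 1) * (c - 2) * x ^ c / (c * x ^ 3) := by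
    rw [hφ3 x hx, Real.rpow_sub_one hx.ne', Real.rpow_sub_one hx.ne', Real.rpow_sub_one hx.ne']
    field_simp
    ring
  have hα' : α = (c - 2) / 2 := by linarith
  rw [hv _ hφpos, h₁, h₂, h₃, add_mul, hconst, hxα, hL, hφ0 x hx, hα']
  field_simp
  ring
end

section
/- Let a, b, u : ℝ → ℂ be functions with a and u differentiable. Let A(t) be the 2×2 matrix [[a(t), b(t)], [1, −a(t)]] and g(t) the unipotent matrix [[1, u(t)], [0, 1]]. Then the gauge transform g·A·g^{−1} − g'·g^{−1} equals the matrix [[a+u, b − 2ua − u² − u'], [1, −a−u]] (pointwise in t). Consequently, g·A·g^{−1} − g'·g^{−1} has the canonical form [[0, v], [1, 0]] for some function v if and only if u = −a, and in that case v = b + a² + a'. -/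
/-- The inverse of a unipotent upper triangular `2 × 2` matrix. -/
theorem Matrix.inv_unipotent_fin_two {R : Type*} [CommRing R] (x : R) :
    (!![1, x; 0, 1])⁻¹ = !![1, -x; 0, 1] :=
  Matrix.inv_eq_right_inv (by simp [Matrix.one_fin_two])

/-- **The `sl₂` Drinfeld–Sokolov canonical form.**  For `A t = [[a t, b t], [1, -a t]]`
and the unipotent gauge `g t = [[1, u t], [0, 1]]` (with `a`, `u` differentiable), the
gauge transform `g A g⁻¹ - g' g⁻¹` equals
`[[a + u, b - 2 u a - u² - u'], [1, -a - u]]`.  Consequently it has the canonical form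
`[[0, v], [1, 0]]` for some function `v` iff `u = -a`, in which case
`v = b + a² + a'`. -/
theorem sl2_drinfeld_sokolov_canonical_form
    (a b u : ℝ → ℂ)
    (ha : Differentiable ℝ a) (hu : Differentiable ℝ u)
    (A g : ℝ → Matrix (Fin 2) (Fin 2) ℂ)
    (hA : ∀ t, A t = !![a t, b t; 1, -a t])
    (hg : ∀ t, g t = !![1, u t; 0, 1])
    (GT : ℝ → Matrix (Fin 2) (Fin 2) ℂ)
    (hGT : ∀ t, GT t = g t * A t * (g t)⁻¹ - !![0, deriv u t; 0, 0] * (g t)⁻¹) :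
    (∀ t, GT t = !![a t + u t, b t - 2 * u t * a t - u t ^ 2 - deriv u t;
                    1, -(a t) - u t]) ∧
    ((∃ v : ℝ → ℂ, ∀ t, GT t = !![0, v t; 1, 0]) ↔ u = fun t => -(a t)) ∧
    ((u = fun t => -(a t)) →
      ∀ t, GT t = !![0, b t + a t ^ 2 + deriv a t; 1, 0]) := by
  have key : ∀ t, GT t = !![a t + u t, b t - 2 * u t * a t - u t ^ 2 - deriv u t;
      1, -(a t) - u t] := by
    intro t
    rw [hGT, hA, hg, Matrix.inv_unipotent_fin_two]
    ext i j
    fin_cases i <;> fin_cases j <;> simp <;> ring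
  have canonical : (u = fun t => -(a t)) →
      ∀ t, GT t = !![0, b t + a t ^ 2 + deriv a t; 1, 0] := by
    intro h t
    have hd : deriv u t = -deriv a t := by rw [h, deriv.fun_neg]
    rw [key, hd, congrFun h t]
    ext i j
    fin_cases i <;> fin_cases j <;> simp
    ring
  refine ⟨key, ⟨?_, fun h => ⟨_, canonical h⟩⟩, canonical⟩
  rintro ⟨v, hv⟩
  funext t
  have h : a t + u t = 0 := by
    simpa using congrFun (congrFun ((key t).symm.trans (hv t)) 0) 0
  exact eq_neg_of_add_eq_zero_right h
end
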